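/- Let e, t ∈ [0,1] be such that the set F = { g : g a graphon with e(g) = e and t(g) = t } is nonempty. Then there exists g₀ ∈ F with I(g₀) ≤ I(g) for all g ∈ F; that is, the infimum of I over F is attained. -/

import Mathlib

open MeasureTheory Real Set Filter

noncomputable section

/-- `I₀(u) = (1/2)[u ln u + (1-u) ln(1-u)]`, with the convention `log 0 = 0`
    giving `I₀(0) = I₀(1) = 0`. -/
def I0 (u : ℝ) : ℝ := (u * Real.log u + (1 - u) * Real.log (1 - u)) / 2

/-- `I₀'(u) = (1/2)[ln u − ln(1−u)]`. -/
def I0d (u : ℝ) : ℝ := (Real.log u - Real.log (1 - u)) / 2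

/-- `I₀''(u) = (1/2)[1/u + 1/(1−u)]`. -/
def I0dd (u : ℝ) : ℝ := (1 / u + 1 / (1 - u)) / 2

/-- A graphon: a measurable, symmetric function `[0,1]² → [0,1]`
    (here defined on all of `ℝ²`, with values used only on `[0,1]²`). -/
def IsGraphon (g : ℝ → ℝ → ℝ) : Prop :=
  Measurable (Function.uncurry g) ∧ (∀ x y, g x y = g y x) ∧ ∀ x y, g x y ∈ Icc (0 : ℝ) 1

/-- The edge density `e(g) = ∫₀¹∫₀¹ g(x,y) dx dy`. -/
def edgeDensity (g : ℝ → ℝ → ℝ) : ℝ :=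
  ∫ x in Icc (0 : ℝ) 1, ∫ y in Icc (0 : ℝ) 1, g x y

/-- The triangle density `t(g) = ∫₀¹∫₀¹∫₀¹ g(x,y) g(y,z) g(z,x) dx dy dz`. -/
def triangleDensity (g : ℝ → ℝ → ℝ) : ℝ :=
  ∫ x in Icc (0 : ℝ) 1, ∫ y in Icc (0 : ℝ) 1, ∫ z in Icc (0 : ℝ) 1, g x y * g y z * g z x

/-- The rate function `I(g) = ∫₀¹∫₀¹ I₀(g(x,y)) dx dy`. -/
def rate (g : ℝ → ℝ → ℝ) : ℝ :=
  ∫ x in Icc (0 : ℝ) 1, ∫ y in Icc (0 : ℝ) 1, I0 (g x y)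

/-- Lebesgue measure restricted to `[0,1]`. -/
def unitMeasure : Measure ℝ := volume.restrict (Icc (0 : ℝ) 1)

/-- Two graphons are equivalent if they agree a.e. after composing with
    measure-preserving maps of `[0,1]`. -/
def GraphonEquiv (f g : ℝ → ℝ → ℝ) : Prop :=
  ∃ σ σ' : ℝ → ℝ, MeasurePreserving σ unitMeasure unitMeasure ∧
    MeasurePreserving σ' unitMeasure unitMeasure ∧
    ∀ᵐ p ∂(unitMeasure.prod unitMeasure), f (σ p.1) (σ p.2) = g (σ' p.1) (σ' p.2)

end

section CutNorm

variable {X : Type*}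

lemma abs_mul_le_of_abs_le {a b A B : ℝ} (ha : |a| ≤ A) (hb : |b| ≤ B) : |a * b| ≤ A * B := by
  rw [abs_mul]
  exact mul_le_mul ha hb (abs_nonneg _) ((abs_nonneg _).trans ha)

/-- A sum of `N` rank-one kernels, each scaled by `ε`. -/
noncomputable def rankOneSum (ε : ℝ) (N : ℕ) (u v : ℕ → X → ℝ) (p : X × X) : ℝ :=
  ε * ∑ i ∈ Finset.range N, u i p.1 * v i p.2

lemma abs_rankOneSum_le {ε : ℝ} (hε : 0 ≤ ε) {N : ℕ} {u v : ℕ → X → ℝ}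
    (hu : ∀ i x, |u i x| ≤ 1) (hv : ∀ i x, |v i x| ≤ 1) (p : X × X) :
    |rankOneSum ε N u v p| ≤ ε * N := by
  unfold rankOneSum
  rw [abs_mul, abs_of_nonneg hε]
  gcongr
  refine (Finset.abs_sum_le_sum_abs _ _).trans ?_
  refine (Finset.sum_le_sum fun i _ => abs_mul_le_of_abs_le (hu i p.1) (hv i p.2)).trans ?_
  simp

lemma rankOneSum_update {ε : ℝ} {N j : ℕ} (hj : j < N) {u v : ℕ → X → ℝ} (hu : u j = 0)
    (f g : X → ℝ) (p : X × X) :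
    rankOneSum ε N (Function.update u j f) (Function.update v j g) p =
      rankOneSum ε N u v p + ε * (f p.1 * g p.2) := by
  have hj' : j ∈ Finset.range N := Finset.mem_range.2 hj
  unfold rankOneSum
  rw [← mul_add, ← Finset.add_sum_erase _ _ hj', ← Finset.add_sum_erase _ _ hj']
  have h : ∀ i ∈ (Finset.range N).erase j,
      Function.update u j f i p.1 * Function.update v j g i p.2 = u i p.1 * v i p.2 := by
    intro i hi
    have hij := Finset.ne_of_mem_erase hi
    simp [Function.update_of_ne hij]
  rw [Finset.sum_congr rfl h]
  simp only [Function.update_self, hu, Pi.zero_apply]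
  ring

variable [MeasurableSpace X]

/-- `A` has cut norm at most `ε` with respect to `μ`. -/
def CutNormLE (μ : Measure X) (ε : ℝ) (A : X × X → ℝ) : Prop :=
  ∀ f g : X → ℝ, Measurable f → Measurable g → (∀ x, |f x| ≤ 1) → (∀ x, |g x| ≤ 1) →
    |∫ p, A p * (f p.1 * g p.2) ∂(μ.prod μ)| ≤ ε

/-- The trilinear triangle functional `∫ A(x,y) B(y,z) C(z,x)`. -/
noncomputable def triangleForm (μ : Measure X) (A B C : X × X → ℝ) : ℝ :=
  ∫ p : (X × X) × X, A p.1 * B (p.1.2, p.2) * C (p.2, p.1.1) ∂((μ.prod μ).prod μ)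

lemma integrable_of_measurable_of_abs_le {μ : Measure X} [IsFiniteMeasure μ] {f : X → ℝ}
    (hf : Measurable f) {C : ℝ} (hC : ∀ x, |f x| ≤ C) : Integrable f μ :=
  Integrable.of_bound hf.aestronglyMeasurable C (ae_of_all _ hC)

lemma abs_integral_le_of_abs_le {μ : Measure X} [IsProbabilityMeasure μ] {f : X → ℝ} {C : ℝ}
    (hC : ∀ x, |f x| ≤ C) : |∫ x, f x ∂μ| ≤ C := by
  simpa using norm_integral_le_of_norm_le_const (μ := μ) (f := f) (ae_of_all _ hC)

lemma measurable_rankOneSum {ε : ℝ} {N : ℕ} {u v : ℕ → X → ℝ} (hu : ∀ i, Measurable (u i))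
    (hv : ∀ i, Measurable (v i)) : Measurable (rankOneSum ε N u v) := by
  unfold rankOneSum
  fun_prop

lemma CutNormLE.abs_integral_le {μ : Measure X} {ε : ℝ} {A : X × X → ℝ} (h : CutNormLE μ ε A)
    {f g : X → ℝ} (hf : Measurable f) (hg : Measurable g) {a b : ℝ} (ha : 0 < a) (hb : 0 < b)
    (hfa : ∀ x, |f x| ≤ a) (hgb : ∀ x, |g x| ≤ b) :
    |∫ p, A p * (f p.1 * g p.2) ∂(μ.prod μ)| ≤ ε * a * b := by
  have h1 := h (fun x => f x / a) (fun x => g x / b) (hf.div_const a) (hg.div_const b)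
    (fun x => by rw [abs_div, abs_of_pos ha]; exact div_le_one_of_le₀ (hfa x) ha.le)
    (fun x => by rw [abs_div, abs_of_pos hb]; exact div_le_one_of_le₀ (hgb x) hb.le)
  have h2 : ∀ p : X × X, A p * (f p.1 * g p.2) =
      (a * b) * (A p * (f p.1 / a * (g p.2 / b))) := fun p => by field_simp
  simp_rw [h2]
  rw [integral_const_mul, abs_mul, abs_of_pos (mul_pos ha hb)]
  calc a * b * _ ≤ a * b * ε := by gcongr
    _ = ε * a * b := by ring

/-- Subtracting a rank-one kernel that correlates with `A` decreases the energy. -/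
lemma integral_sq_sub_le {μ : Measure X} [IsProbabilityMeasure μ] {A : X × X → ℝ} {M : ℝ}
    (hA : Measurable A) (hM : ∀ p, |A p| ≤ M) {f g : X → ℝ} (hf : Measurable f)
    (hg : Measurable g) (hf1 : ∀ x, |f x| ≤ 1) (hg1 : ∀ x, |g x| ≤ 1) {ε : ℝ} (hε : 0 ≤ ε)
    (h : ε ≤ ∫ p, A p * (f p.1 * g p.2) ∂(μ.prod μ)) :
    ∫ p, (A p - ε * (f p.1 * g p.2)) ^ 2 ∂(μ.prod μ) ≤ ∫ p, A p ^ 2 ∂(μ.prod μ) - ε ^ 2 := by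
  have hfg : ∀ p : X × X, |f p.1 * g p.2| ≤ 1 := fun p => by
    simpa using abs_mul_le_of_abs_le (hf1 p.1) (hg1 p.2)
  have i1 : Integrable (fun p => A p ^ 2) (μ.prod μ) :=
    integrable_of_measurable_of_abs_le (hA.pow_const 2) (C := M ^ 2) fun p => by
      rw [abs_pow]; exact pow_le_pow_left₀ (abs_nonneg _) (hM p) 2
  have i2 : Integrable (fun p : X × X => A p * (f p.1 * g p.2)) (μ.prod μ) :=
    integrable_of_measurable_of_abs_le (by fun_prop)
      fun p => abs_mul_le_of_abs_le (hM p) (hfg p)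
  have i3 : Integrable (fun p : X × X => A p ^ 2 - 2 * ε * (A p * (f p.1 * g p.2)))
      (μ.prod μ) := i1.sub (i2.const_mul _)
  calc ∫ p, (A p - ε * (f p.1 * g p.2)) ^ 2 ∂(μ.prod μ)
      ≤ ∫ p, (A p ^ 2 - 2 * ε * (A p * (f p.1 * g p.2)) + ε ^ 2) ∂(μ.prod μ) := by
        refine integral_mono_of_nonneg (ae_of_all _ fun p => sq_nonneg _)
          (i3.add (integrable_const _)) (ae_of_all _ fun p => ?_)
        have := (sq_le_one_iff_abs_le_one _).2 (hfg p)
        have := mul_le_mul_of_nonneg_left this (sq_nonneg ε)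
        simp only
        nlinarith
    _ = ∫ p, A p ^ 2 ∂(μ.prod μ) - 2 * ε * ∫ p, A p * (f p.1 * g p.2) ∂(μ.prod μ) + ε ^ 2 := by
        rw [integral_add i3 (integrable_const _), integral_sub i1 (i2.const_mul _),
          integral_const_mul]
        simp
    _ ≤ _ := by nlinarith [mul_le_mul_of_nonneg_left h hε]

/-- Weak regularity: a kernel bounded by one is approximated in cut norm by boundedly many
rank-one kernels. -/
lemma exists_cutNormLE_sub_rankOneSum (μ : Measure X) [IsProbabilityMeasure μ] {W : X × X → ℝ}
    (hW : Measurable W) (hW1 : ∀ p, |W p| ≤ 1) {ε : ℝ} (hε : 0 < ε) {N : ℕ}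
    (hN : 1 < N * ε ^ 2) :
    ∃ u v : ℕ → X → ℝ, (∀ i, Measurable (u i)) ∧ (∀ i, Measurable (v i)) ∧
      (∀ i x, |u i x| ≤ 1) ∧ (∀ i x, |v i x| ≤ 1) ∧
      CutNormLE μ ε (fun p => W p - rankOneSum ε N u v p) := by
  by_contra! hcon
  have key : ∀ j ≤ N, ∃ u v : ℕ → X → ℝ, (∀ i, Measurable (u i)) ∧ (∀ i, Measurable (v i)) ∧
      (∀ i x, |u i x| ≤ 1) ∧ (∀ i x, |v i x| ≤ 1) ∧ (∀ i, j ≤ i → u i = 0) ∧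
      ∫ p, (W p - rankOneSum ε N u v p) ^ 2 ∂(μ.prod μ) ≤ 1 - j * ε ^ 2 := by
    intro j
    induction j with
    | zero =>
      intro _
      refine ⟨fun _ => 0, fun _ => 0, fun _ => measurable_zero, fun _ => measurable_zero,
        by simp, by simp, by simp, ?_⟩
      refine (le_abs_self _).trans (abs_integral_le_of_abs_le fun p => ?_)
      simpa [rankOneSum] using hW1 p
    | succ j ih =>
      intro hj
      obtain ⟨u, v, hu, hv, hu1, hv1, h0, hen⟩ := ih (by omega)
      have hnot := hcon u v hu hv hu1 hv1
      unfold CutNormLE at hnot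
      push Not at hnot
      obtain ⟨f, g, hf, hg, hf1, hg1, hlt⟩ := hnot
      obtain ⟨f', hf', hf1', hlt'⟩ : ∃ f' : X → ℝ, Measurable f' ∧ (∀ x, |f' x| ≤ 1) ∧
          ε ≤ ∫ p, (W p - rankOneSum ε N u v p) * (f' p.1 * g p.2) ∂(μ.prod μ) := by
        rcases lt_abs.1 hlt with h | h
        · exact ⟨f, hf, hf1, h.le⟩
        · refine ⟨fun x => - f x, hf.neg, fun x => by simpa using hf1 x, ?_⟩
          simp only [neg_mul, mul_neg, integral_neg]
          exact h.le
      have hupd : ∀ (w : ℕ → X → ℝ) (k : X → ℝ), (∀ i, Measurable (w i)) → Measurable k →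
          ∀ i, Measurable (Function.update w j k i) := by
        intro w k hw hk i
        rcases eq_or_ne i j with rfl | hij
        · simpa using hk
        · simpa [Function.update_of_ne hij] using hw i
      have hupd1 : ∀ (w : ℕ → X → ℝ) (k : X → ℝ), (∀ i x, |w i x| ≤ 1) → (∀ x, |k x| ≤ 1) →
          ∀ i x, |Function.update w j k i x| ≤ 1 := by
        intro w k hw hk i x
        rcases eq_or_ne i j with rfl | hij
        · simpa using hk x
        · simpa [Function.update_of_ne hij] using hw i x
      refine ⟨Function.update u j f', Function.update v j g, hupd u f' hu hf', hupd v g hv hg,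
        hupd1 u f' hu1 hf1', hupd1 v g hv1 hg1, fun i hi => ?_, ?_⟩
      · rw [Function.update_of_ne (by omega)]
        exact h0 i (by omega)
      · simp_rw [rankOneSum_update (show j < N by omega) (h0 j le_rfl), ← sub_sub]
        refine (integral_sq_sub_le (hW.sub (measurable_rankOneSum hu hv)) (M := 1 + ε * N)
          (fun p => (abs_sub _ _).trans
            (add_le_add (hW1 p) (abs_rankOneSum_le hε.le hu1 hv1 p)))
          hf' hg hf1' hg1 hε.le hlt').trans ?_
        push_cast
        simp only [Pi.sub_apply]
        linarith
  obtain ⟨u, v, -, -, -, -, -, h⟩ := key N le_rfl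
  have : 0 ≤ ∫ p, (W p - rankOneSum ε N u v p) ^ 2 ∂(μ.prod μ) :=
    integral_nonneg fun p => sq_nonneg _
  linarith

section Triangle

variable {μ : Measure X} [IsProbabilityMeasure μ] {A A' B C : X × X → ℝ}

lemma integrable_triangle (hA : Measurable A) (hB : Measurable B) (hC : Measurable C)
    {a b c : ℝ} (ha : ∀ p, |A p| ≤ a) (hb : ∀ p, |B p| ≤ b) (hc : ∀ p, |C p| ≤ c) :
    Integrable (fun p : (X × X) × X => A p.1 * B (p.1.2, p.2) * C (p.2, p.1.1))
      ((μ.prod μ).prod μ) :=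
  integrable_of_measurable_of_abs_le (by fun_prop)
    fun _ => abs_mul_le_of_abs_le (abs_mul_le_of_abs_le (ha _) (hb _)) (hc _)

lemma triangleForm_rotate (μ : Measure X) [IsProbabilityMeasure μ] (A B C : X × X → ℝ) :
    triangleForm μ A B C = triangleForm μ B C A := by
  unfold triangleForm
  let e : (X × X) × X ≃ᵐ (X × X) × X := MeasurableEquiv.prodAssoc.trans MeasurableEquiv.prodComm
  have he : MeasurePreserving e ((μ.prod μ).prod μ) ((μ.prod μ).prod μ) :=
    (measurePreserving_prodAssoc μ μ μ).trans Measure.measurePreserving_swap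
  rw [← he.integral_comp' (fun p => B p.1 * C (p.1.2, p.2) * A (p.2, p.1.1))]
  refine integral_congr_ae (ae_of_all _ fun p => ?_)
  change _ = B (p.1.2, p.2) * C (p.2, p.1.1) * A (p.1.1, p.1.2)
  ring

lemma triangleForm_sub (hA : Measurable A) (hA' : Measurable A') (hB : Measurable B)
    (hC : Measurable C) {a a' b c : ℝ} (ha : ∀ p, |A p| ≤ a) (ha' : ∀ p, |A' p| ≤ a')
    (hb : ∀ p, |B p| ≤ b) (hc : ∀ p, |C p| ≤ c) :
    triangleForm μ A B C - triangleForm μ A' B C =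
      triangleForm μ (fun p => A p - A' p) B C := by
  unfold triangleForm
  rw [← integral_sub (integrable_triangle hA hB hC ha hb hc)
    (integrable_triangle hA' hB hC ha' hb hc)]
  congr with p
  ring

lemma abs_triangleForm_le {ε a b c : ℝ} (h : CutNormLE μ ε A) (hA : Measurable A)
    (hB : Measurable B) (hC : Measurable C) (hb0 : 0 < b) (hc0 : 0 < c)
    (ha : ∀ p, |A p| ≤ a) (hb : ∀ p, |B p| ≤ b) (hc : ∀ p, |C p| ≤ c) :
    |triangleForm μ A B C| ≤ ε * b * c := by
  unfold triangleForm
  rw [integral_prod_symm _ (integrable_triangle hA hB hC ha hb hc)]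
  refine abs_integral_le_of_abs_le fun z => ?_
  have := h.abs_integral_le (f := fun x => C (z, x)) (g := fun y => B (y, z)) (by fun_prop)
    (by fun_prop) hc0 hb0 (fun x => hc _) (fun y => hb _)
  calc _ = |∫ p, A p * (C (z, p.1) * B (p.2, z)) ∂(μ.prod μ)| := by
        congr 2 with p
        ring
    _ ≤ _ := this.trans_eq (by ring)

/-- Two of the three factors of the triangle density may be replaced by cut-norm approximations,
where the second error is weighted by the bound on the first approximation. -/
lemma abs_triangleForm_sub_le {W S T : X × X → ℝ} {ε δ s r : ℝ} (hW : Measurable W)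
    (hS : Measurable S) (hT : Measurable T) (hs0 : 0 < s) (hW1 : ∀ p, |W p| ≤ 1)
    (hs : ∀ p, |S p| ≤ s) (hr : ∀ p, |T p| ≤ r) (hWS : CutNormLE μ ε (fun p => W p - S p))
    (hWT : CutNormLE μ δ (fun p => W p - T p)) :
    |triangleForm μ W W W - triangleForm μ W S T| ≤ ε + δ * s := by
  have h1 : |triangleForm μ W W W - triangleForm μ S W W| ≤ ε := by
    rw [triangleForm_sub hW hS hW hW hW1 hs hW1 hW1]
    simpa using abs_triangleForm_le hWS (hW.sub hS) hW hW one_pos one_pos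
      (fun p => (abs_sub _ _).trans (add_le_add (hW1 p) (hs p))) hW1 hW1
  have h2 : |triangleForm μ S W W - triangleForm μ W S T| ≤ δ * s := by
    have e1 : triangleForm μ S W W = triangleForm μ W W S := triangleForm_rotate μ S W W
    have e2 : triangleForm μ W S T = triangleForm μ T W S := by
      rw [triangleForm_rotate μ W, triangleForm_rotate μ S]
    rw [e1, e2, triangleForm_sub hW hT hW hS hW1 hr hW1 hs]
    simpa using abs_triangleForm_le hWT (hW.sub hT) hW hS one_pos hs0
      (fun p => (abs_sub _ _).trans (add_le_add (hW1 p) (hr p))) hW1 hs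
  calc _ ≤ _ := abs_sub_le _ (triangleForm μ S W W) _
    _ ≤ _ := add_le_add h1 h2

end Triangle

end CutNorm

section RateFunction

lemma I0_eq_neg_binEntropy (u : ℝ) : I0 u = -(1 / 2 : ℝ) * binEntropy u := by
  simp only [I0, binEntropy, Real.log_inv]
  ring

lemma continuous_I0 : Continuous I0 := by
  rw [funext I0_eq_neg_binEntropy]
  fun_prop

lemma convexOn_I0 : ConvexOn ℝ (Icc 0 1) I0 := by
  have h := strictConcave_binEntropy.concaveOn.neg.smul (c := (1 / 2 : ℝ)) (by norm_num)
  refine h.congr fun u _ => ?_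
  simp [I0_eq_neg_binEntropy]

lemma abs_I0_le {u : ℝ} (hu : u ∈ Icc (0 : ℝ) 1) : |I0 u| ≤ 1 := by
  have h0 := binEntropy_nonneg hu.1 hu.2
  have h1 : binEntropy u ≤ Real.log 2 := binEntropy_le_log_two
  have h2 := Real.log_two_lt_d9
  rw [I0_eq_neg_binEntropy, abs_le]
  constructor <;> linarith

end RateFunction

section ConditionalMean

variable {Y : Type*} [MeasurableSpace Y]

/-- Conditioning a `[0,1]`-valued variable on the first coordinate gives a measurable function with
the same averages and, by Jensen's inequality, no larger rate. -/
lemma exists_conditionalMean (ρ : Measure (Y × unitInterval)) [IsProbabilityMeasure ρ] :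
    ∃ U : Y → ℝ, Measurable U ∧ (∀ y, U y ∈ Icc (0 : ℝ) 1) ∧
      (∀ φ : Y → ℝ, Measurable φ → ∀ C, (∀ y, |φ y| ≤ C) →
        ∫ y, U y * φ y ∂ρ.fst = ∫ p, (p.2 : ℝ) * φ p.1 ∂ρ) ∧
      ∫ y, I0 (U y) ∂ρ.fst ≤ ∫ p, I0 p.2 ∂ρ := by
  have hw : Measurable fun w : unitInterval => (w : ℝ) := measurable_subtype_coe
  have habs : ∀ w : unitInterval, |(w : ℝ)| ≤ 1 := fun w => by
    rw [abs_of_nonneg w.2.1]; exact w.2.2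
  have hiw : ∀ y, Integrable (fun w : unitInterval => (w : ℝ)) (ρ.condKernel y) := fun y =>
    integrable_of_measurable_of_abs_le hw habs
  have hI : Measurable I0 := continuous_I0.measurable
  have hUm : Measurable fun y => ∫ w, (w : ℝ) ∂(ρ.condKernel y) :=
    (StronglyMeasurable.integral_kernel (f := fun w : unitInterval => (w : ℝ))
      hw.stronglyMeasurable).measurable
  have hU01 : ∀ y, ∫ w, (w : ℝ) ∂(ρ.condKernel y) ∈ Icc (0 : ℝ) 1 := fun y =>
    ⟨integral_nonneg fun w => w.2.1, (le_abs_self _).trans (abs_integral_le_of_abs_le habs)⟩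
  refine ⟨fun y => ∫ w, (w : ℝ) ∂(ρ.condKernel y), hUm, hU01, fun φ hφ C hC => ?_, ?_⟩
  · rw [← Measure.integral_condKernel]
    · simp_rw [integral_mul_const]
    · exact integrable_of_measurable_of_abs_le (by fun_prop)
        fun p => abs_mul_le_of_abs_le (habs p.2) (hC p.1)
  · have hI0 : Integrable (fun p : Y × unitInterval => I0 p.2) ρ :=
      integrable_of_measurable_of_abs_le (by fun_prop) fun p => abs_I0_le p.2.2
    rw [← Measure.integral_condKernel hI0]
    refine integral_mono (integrable_of_measurable_of_abs_le (hI.comp hUm)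
      fun y => abs_I0_le (hU01 y)) hI0.integral_condKernel fun y => ?_
    exact convexOn_I0.map_integral_le continuous_I0.continuousOn isClosed_Icc
      (ae_of_all _ fun w => w.2) (hiw y)
      (integrable_of_measurable_of_abs_le (hI.comp hw) fun w => abs_I0_le w.2)

end ConditionalMean

section Density

variable {Ω : Type*} [TopologicalSpace Ω] [NormalSpace Ω] [MeasurableSpace Ω]
  [BorelSpace Ω]

lemma exists_continuous_integral_abs_sub_le (μ : Measure Ω) [IsFiniteMeasure μ]
    [μ.WeaklyRegular] {f : Ω → ℝ} (hf : Measurable f) (hf1 : ∀ x, |f x| ≤ 1) {δ : ℝ}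
    (hδ : 0 < δ) :
    ∃ g : Ω → ℝ, Continuous g ∧ (∀ x, |g x| ≤ 1) ∧ ∫ x, |f x - g x| ∂μ ≤ δ := by
  have hi := integrable_of_measurable_of_abs_le (μ := μ) hf hf1
  obtain ⟨h, hle, hint⟩ := hi.exists_boundedContinuous_integral_sub_le hδ
  have hg1 : ∀ x, |max (-1) (min 1 (h x))| ≤ 1 := fun x => by
    rw [abs_le]
    exact ⟨le_max_left _ _, max_le (by norm_num) (min_le_left _ _)⟩
  have hgc : Continuous fun x => max (-1) (min 1 (h x)) := by fun_prop
  refine ⟨_, hgc, hg1, (integral_mono ?_ (hi.sub hint).abs fun x => ?_).trans hle⟩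
  · exact (hi.sub (integrable_of_measurable_of_abs_le hgc.measurable hg1)).abs
  · have h1 := abs_le.1 (hf1 x)
    have h2 : f x = max (-1) (min 1 (f x)) := by rw [min_eq_right h1.2, max_eq_right h1.1]
    calc |f x - max (-1) (min 1 (h x))|
        = |max (-1) (min 1 (f x)) - max (-1) (min 1 (h x))| := by rw [← h2]
      _ ≤ |min 1 (f x) - min 1 (h x)| := by
        simpa [max_comm] using abs_max_sub_max_le_abs (min 1 (f x)) (min 1 (h x)) (-1)
      _ ≤ |f x - h x| := by
        simpa [min_comm] using abs_min_sub_min_le_max 1 (f x) 1 (h x)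

/-- The cut norm may be computed with continuous test functions. -/
lemma cutNormLE_of_continuous (μ : Measure Ω) [IsProbabilityMeasure μ]
    [μ.WeaklyRegular] {A : Ω × Ω → ℝ} (hA : Measurable A) {M : ℝ} (hM : ∀ p, |A p| ≤ M) {ε : ℝ}
    (h : ∀ f g : Ω → ℝ, Continuous f → Continuous g → (∀ x, |f x| ≤ 1) → (∀ x, |g x| ≤ 1) →
      |∫ p, A p * (f p.1 * g p.2) ∂(μ.prod μ)| ≤ ε) : CutNormLE μ ε A := by
  intro f g hf hg hf1 hg1
  obtain ⟨x₀⟩ : Nonempty Ω := μ.nonempty_of_neZero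
  have hM0 : 0 ≤ M := (abs_nonneg _).trans (hM (x₀, x₀))
  refine le_of_forall_pos_le_add fun η hη => ?_
  obtain ⟨δ, hδ, hδη⟩ : ∃ δ > 0, M * (δ + δ) ≤ η := by
    refine ⟨η / (2 * (M + 1)), by positivity, ?_⟩
    have : M * (η / (2 * (M + 1)) + η / (2 * (M + 1))) = η * (M / (M + 1)) := by
      field_simp; ring
    rw [this]
    exact mul_le_of_le_one_right hη.le (div_le_one_of_le₀ (by linarith) (by linarith))
  obtain ⟨f', hf', hf1', hfδ⟩ := exists_continuous_integral_abs_sub_le μ hf hf1 hδ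
  obtain ⟨g', hg', hg1', hgδ⟩ := exists_continuous_integral_abs_sub_le μ hg hg1 hδ
  have hf'm := hf'.measurable
  have hg'm := hg'.measurable
  have i1 : Integrable (fun p : Ω × Ω => A p * (f p.1 * g p.2)) (μ.prod μ) :=
    integrable_of_measurable_of_abs_le (by fun_prop)
      fun p => abs_mul_le_of_abs_le (hM p) (abs_mul_le_of_abs_le (hf1 _) (hg1 _))
  have i2 : Integrable (fun p : Ω × Ω => A p * (f' p.1 * g' p.2)) (μ.prod μ) :=
    integrable_of_measurable_of_abs_le (by fun_prop)
      fun p => abs_mul_le_of_abs_le (hM p) (abs_mul_le_of_abs_le (hf1' _) (hg1' _))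
  have i3 : Integrable (fun x => |f x - f' x|) μ :=
    ((integrable_of_measurable_of_abs_le hf hf1).sub
      (integrable_of_measurable_of_abs_le hf'm hf1')).abs
  have i4 : Integrable (fun x => |g x - g' x|) μ :=
    ((integrable_of_measurable_of_abs_le hg hg1).sub
      (integrable_of_measurable_of_abs_le hg'm hg1')).abs
  have e1 : ∫ p, |f p.1 - f' p.1| ∂(μ.prod μ) = ∫ x, |f x - f' x| ∂μ := by
    simpa using integral_fun_fst (μ := μ) (ν := μ) fun x => |f x - f' x|
  have e2 : ∫ p, |g p.2 - g' p.2| ∂(μ.prod μ) = ∫ x, |g x - g' x| ∂μ := by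
    simpa using integral_fun_snd (μ := μ) (ν := μ) fun x => |g x - g' x|
  have hdiff : |∫ p, A p * (f p.1 * g p.2) ∂(μ.prod μ) -
      ∫ p, A p * (f' p.1 * g' p.2) ∂(μ.prod μ)| ≤ M * (δ + δ) := by
    rw [← integral_sub i1 i2]
    calc _ ≤ ∫ p, M * (|f p.1 - f' p.1| + |g p.2 - g' p.2|) ∂(μ.prod μ) := by
          refine (abs_integral_le_integral_abs).trans (integral_mono (i1.sub i2).abs
            (((i3.comp_fst μ).add (i4.comp_snd μ)).const_mul M) fun p => ?_)
          simp only [← mul_sub]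
          refine abs_mul_le_of_abs_le (hM p) ?_
          have : f p.1 * g p.2 - f' p.1 * g' p.2 =
            (f p.1 - f' p.1) * g p.2 + f' p.1 * (g p.2 - g' p.2) := by ring
          rw [this]
          refine (abs_add_le _ _).trans (add_le_add ?_ ?_)
          · simpa using abs_mul_le_of_abs_le (le_refl |f p.1 - f' p.1|) (hg1 p.2)
          · simpa using abs_mul_le_of_abs_le (hf1' p.1) (le_refl |g p.2 - g' p.2|)
      _ = M * (∫ x, |f x - f' x| ∂μ + ∫ x, |g x - g' x| ∂μ) := by
          rw [integral_const_mul, integral_add (i3.comp_fst μ) (i4.comp_snd μ), e1, e2]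
      _ ≤ _ := by gcongr
  have := h f' g' hf' hg' hf1' hg1'
  have := abs_sub_abs_le_abs_sub (∫ p, A p * (f p.1 * g p.2) ∂(μ.prod μ))
    (∫ p, A p * (f' p.1 * g' p.2) ∂(μ.prod μ))
  linarith

end Density

section WeakLimit

open scoped Topology

variable {Ω : Type*} [TopologicalSpace Ω] [CompactSpace Ω] [MeasurableSpace Ω] [BorelSpace Ω]

lemma tendsto_integral_of_tendsto {ι : Type*} {l : Filter ι}
    {m : ι → ProbabilityMeasure Ω} {m₀ : ProbabilityMeasure Ω} (h : Tendsto m l (𝓝 m₀))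
    {F : Ω → ℝ} (hF : Continuous F) :
    Tendsto (fun i => ∫ ω, F ω ∂(m i : Measure Ω)) l (𝓝 (∫ ω, F ω ∂(m₀ : Measure Ω))) :=
  ProbabilityMeasure.tendsto_iff_forall_integral_tendsto.1 h
    (BoundedContinuousFunction.mkOfCompact ⟨F, hF⟩)

variable {X : Type*} [MeasurableSpace X] [T2Space Ω] [SecondCountableTopology Ω]

/-- Kernels `W n` on a probability space, read through codes `c n` in a compact space, have a weak
limit: a law of two code points and a value whose code points are independent. -/
lemma exists_weak_limit (μ : Measure X) [IsProbabilityMeasure μ] {W : ℕ → X × X → unitInterval}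
    (hW : ∀ n, Measurable (W n)) {c : ℕ → X → Ω} (hc : ∀ n, Measurable (c n)) :
    ∃ (l : Filter ℕ) (ν : ProbabilityMeasure Ω)
      (ρ : ProbabilityMeasure ((Ω × Ω) × unitInterval)), l.NeBot ∧ l ≤ atTop ∧
      (ρ : Measure ((Ω × Ω) × unitInterval)).fst = (ν : Measure Ω).prod ν ∧
      (∀ F : (Ω × Ω) × unitInterval → ℝ, Continuous F →
        Tendsto (fun n => ∫ p, F ((c n p.1, c n p.2), W n p) ∂(μ.prod μ)) l
          (𝓝 (∫ p, F p ∂(ρ : Measure ((Ω × Ω) × unitInterval))))) ∧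
      (∀ F : ((Ω × Ω) × unitInterval) × Ω → ℝ, Continuous F →
        Tendsto (fun n => ∫ p, F (((c n p.1.1, c n p.1.2), W n p.1), c n p.2)
          ∂((μ.prod μ).prod μ)) l
          (𝓝 (∫ p, F p ∂((ρ : Measure ((Ω × Ω) × unitInterval)).prod (ν : Measure Ω))))) := by
  have hd : ∀ n, Measurable fun p : X × X => ((c n p.1, c n p.2), W n p) := fun n => by
    have := hW n
    have := hc n
    fun_prop
  let m : ℕ → ProbabilityMeasure Ω := fun n =>
    ⟨μ.map (c n), Measure.isProbabilityMeasure_map (hc n).aemeasurable⟩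
  let r : ℕ → ProbabilityMeasure ((Ω × Ω) × unitInterval) := fun n =>
    ⟨(μ.prod μ).map fun p => ((c n p.1, c n p.2), W n p),
      Measure.isProbabilityMeasure_map (hd n).aemeasurable⟩
  let l : Ultrafilter ℕ := hyperfilter ℕ
  obtain ⟨ν, -, hν⟩ := isCompact_univ.ultrafilter_le_nhds (l.map m) (by simp)
  obtain ⟨ρ, -, hρ⟩ := isCompact_univ.ultrafilter_le_nhds (l.map r) (by simp)
  replace hν : Tendsto m l (𝓝 ν) := hν
  replace hρ : Tendsto r l (𝓝 ρ) := hρ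
  have hprod : Tendsto (fun n => (r n).prod (m n)) l (𝓝 (ρ.prod ν)) :=
    (ProbabilityMeasure.continuous_prod.tendsto (ρ, ν)).comp (hρ.prodMk_nhds hν)
  refine ⟨l, ν, ρ, inferInstance, ?_, ?_, fun F hF => ?_, fun F hF => ?_⟩
  · rw [← Nat.cofinite_eq_atTop]
    exact hyperfilter_le_cofinite
  · have h1 : Tendsto (fun n => (m n).prod (m n)) l (𝓝 (ν.prod ν)) :=
      (ProbabilityMeasure.continuous_prod.tendsto (ν, ν)).comp (hν.prodMk_nhds hν)
    have h2 := ((ProbabilityMeasure.continuous_map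
      (continuous_fst (X := Ω × Ω) (Y := unitInterval))).tendsto ρ).comp hρ
    have h3 : (fun n => (m n).prod (m n)) = (fun ν => ProbabilityMeasure.map ν
        (continuous_fst (X := Ω × Ω) (Y := unitInterval)).measurable.aemeasurable) ∘ r := by
      funext n
      apply Subtype.ext
      change (μ.map (c n)).prod (μ.map (c n)) = Measure.map Prod.fst (Measure.map _ (μ.prod μ))
      rw [Measure.map_map measurable_fst (hd n), Measure.map_prod_map μ μ (hc n) (hc n)]
      rfl
    rw [h3] at h1
    have := congrArg (fun ν : ProbabilityMeasure (Ω × Ω) => (ν : Measure (Ω × Ω)))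
      (tendsto_nhds_unique h2 h1)
    exact this
  · have := tendsto_integral_of_tendsto hρ hF
    refine this.congr fun n => ?_
    exact integral_map (hd n).aemeasurable hF.aestronglyMeasurable
  · have := tendsto_integral_of_tendsto hprod hF
    refine this.congr fun n => ?_
    change ∫ p, F p ∂((Measure.map _ (μ.prod μ)).prod (μ.map (c n))) = _
    rw [Measure.map_prod_map _ _ (hd n) (hc n), integral_map
      ((hd n).prodMap (hc n)).aemeasurable hF.aestronglyMeasurable]
    rfl

end WeakLimit

section LimitKernel

open scoped Topology

variable {X : Type*} [MeasurableSpace X] {Ω : Type*} [TopologicalSpace Ω] [CompactSpace Ω]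
  [T2Space Ω] [SecondCountableTopology Ω] [MeasurableSpace Ω] [BorelSpace Ω]

lemma abs_coe_unitInterval_le (w : unitInterval) : |(w : ℝ)| ≤ 1 := by
  rw [abs_of_nonneg w.2.1]
  exact w.2.2

/-- If kernels are uniformly approximated in cut norm by continuous functions of compact codes,
then there is a limit kernel with the limiting densities and no larger rate. -/
theorem exists_limit_kernel_of_code (μ : Measure X) [IsProbabilityMeasure μ]
    {W : ℕ → X × X → unitInterval} (hW : ∀ n, Measurable (W n))
    (hsymm : ∀ n p, W n p.swap = W n p) {c : ℕ → X → Ω} (hc : ∀ n, Measurable (c n))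
    {S : ℕ → Ω × Ω → ℝ} (hS : ∀ k, Continuous (S k)) {M : ℕ → ℝ} (hM0 : ∀ k, 0 < M k)
    (hM : ∀ k p, |S k p| ≤ M k) {ε : ℕ → ℝ} (hε : Tendsto ε atTop (𝓝 0))
    (hcut : ∀ n k, CutNormLE μ (ε k) fun p => (W n p : ℝ) - S k (c n p.1, c n p.2))
    {e t i : ℝ} (he : ∀ n, ∫ p, (W n p : ℝ) ∂(μ.prod μ) = e)
    (ht : ∀ n, triangleForm μ (fun p => W n p) (fun p => W n p) (fun p => W n p) = t)
    (hi : Tendsto (fun n => ∫ p, I0 (W n p) ∂(μ.prod μ)) atTop (𝓝 i)) :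
    ∃ (ν : Measure Ω) (U : Ω × Ω → ℝ), IsProbabilityMeasure ν ∧ Measurable U ∧
      (∀ p, U p ∈ Icc (0 : ℝ) 1) ∧ (∀ p, U p.swap = U p) ∧ ∫ p, U p ∂(ν.prod ν) = e ∧
      triangleForm ν U U U = t ∧ ∫ p, I0 (U p) ∂(ν.prod ν) ≤ i := by
  obtain ⟨l, ν', ρ', hl, hle, hfst, hlim, hlim'⟩ := exists_weak_limit μ hW hc
  set ν : Measure Ω := ν'.toMeasure
  set ρ : Measure ((Ω × Ω) × unitInterval) := ρ'.toMeasure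
  obtain ⟨V, hVm, hV01, hV, hVI⟩ := exists_conditionalMean ρ
  rw [hfst] at hV hVI
  have hbdd : ∀ {φ : Ω × Ω → ℝ}, Continuous φ → ∃ C, ∀ p, |φ p| ≤ C := fun {φ} hφ => by
    obtain ⟨C, hC⟩ := isCompact_univ.exists_bound_of_continuousOn hφ.continuousOn
    exact ⟨C, fun p => hC p (mem_univ p)⟩
  have hVabs : ∀ p, |V p| ≤ 1 := fun p => by
    rw [abs_of_nonneg (hV01 p).1]; exact (hV01 p).2
  have hVswap : Measurable fun p : Ω × Ω => V p.swap := hVm.comp measurable_swap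
  let U : Ω × Ω → ℝ := fun p => (V p + V p.swap) / 2
  have hUm : Measurable U := (hVm.add hVswap).div_const 2
  have hU01 : ∀ p, U p ∈ Icc (0 : ℝ) 1 := fun p => by
    have h1 := hV01 p
    have h2 := hV01 p.swap
    constructor
    · change 0 ≤ (V p + V p.swap) / 2
      linarith [h1.1, h2.1]
    · change (V p + V p.swap) / 2 ≤ 1
      linarith [h1.2, h2.2]
  have hUabs : ∀ p, |U p| ≤ 1 := fun p => by
    rw [abs_of_nonneg (hU01 p).1]; exact (hU01 p).2
  have hUsymm : ∀ p, U p.swap = U p := fun p => by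
    simp only [U, Prod.swap_swap, add_comm]
  have hρswap : ∀ φ : Ω × Ω → ℝ, Continuous φ →
      ∫ p, (p.2 : ℝ) * φ p.1.swap ∂ρ = ∫ p, (p.2 : ℝ) * φ p.1 ∂ρ := by
    intro φ hφ
    have h1 := hlim (fun p => (p.2 : ℝ) * φ p.1.swap) (by fun_prop)
    have h2 := hlim (fun p => (p.2 : ℝ) * φ p.1) (by fun_prop)
    refine tendsto_nhds_unique h1 (h2.congr fun n => ?_)
    rw [← integral_prod_swap]
    simp only [hsymm, Prod.fst_swap, Prod.snd_swap, Prod.swap_prod_mk]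
  have hU : ∀ φ : Ω × Ω → ℝ, Continuous φ →
      ∫ p, U p * φ p ∂(ν.prod ν) = ∫ p, (p.2 : ℝ) * φ p.1 ∂ρ := by
    intro φ hφ
    obtain ⟨C, hC⟩ := hbdd hφ
    have hφm := hφ.measurable
    have h1 := hV φ hφm C hC
    have h2 := hV (fun p => φ p.swap) (hφm.comp measurable_swap) C fun p => hC _
    rw [hρswap φ hφ, ← integral_prod_swap] at h2
    simp only [Prod.swap_swap] at h2
    have h3 : ∀ p, U p * φ p = (V p * φ p + V p.swap * φ p) / 2 := fun p => by
      simp only [U]; ring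
    simp_rw [h3]
    rw [integral_div, integral_add, h1, h2, add_self_div_two]
    · exact integrable_of_measurable_of_abs_le (by fun_prop)
        fun p => abs_mul_le_of_abs_le (hVabs p) (hC p)
    · exact integrable_of_measurable_of_abs_le (by fun_prop)
        fun p => abs_mul_le_of_abs_le (hVabs p.swap) (hC p)
  have hUe : ∫ p, U p ∂(ν.prod ν) = e := by
    have h1 := hlim (fun p => (p.2 : ℝ) * 1) (by fun_prop)
    have h2 := hU (fun _ => 1) continuous_const
    rw [← h2] at h1
    simp only [mul_one, he] at h1
    exact tendsto_nhds_unique h1 tendsto_const_nhds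
  have hI := continuous_I0.measurable
  have hUI : ∫ p, I0 (U p) ∂(ν.prod ν) ≤ i := by
    have h1 : ∫ p, I0 p.2 ∂ρ = i :=
      tendsto_nhds_unique (hlim (fun p => I0 p.2)
        (continuous_I0.comp (continuous_subtype_val.comp continuous_snd))) (hi.mono_left hle)
    have i1 : Integrable (fun p => I0 (V p)) (ν.prod ν) :=
      integrable_of_measurable_of_abs_le (hI.comp hVm) fun p => abs_I0_le (hV01 p)
    have i2 : Integrable (fun p => I0 (V p.swap)) (ν.prod ν) :=
      integrable_of_measurable_of_abs_le (hI.comp hVswap) fun p => abs_I0_le (hV01 p.swap)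
    calc ∫ p, I0 (U p) ∂(ν.prod ν) ≤ ∫ p, (I0 (V p) + I0 (V p.swap)) / 2 ∂(ν.prod ν) := by
          refine integral_mono (integrable_of_measurable_of_abs_le (hI.comp hUm)
            fun p => abs_I0_le (hU01 p)) ((i1.add i2).div_const 2) fun p => ?_
          have := convexOn_I0.2 (hV01 p) (hV01 p.swap) (one_half_pos (α := ℝ)).le
            (one_half_pos (α := ℝ)).le (by norm_num)
          simp only [smul_eq_mul] at this
          have hUp : U p = 1 / 2 * V p + 1 / 2 * V p.swap := by simp only [U]; ring
          simp only [hUp]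
          linarith
      _ = ∫ p, I0 (V p) ∂(ν.prod ν) := by
          rw [integral_div, integral_add i1 i2, integral_prod_swap (fun p => I0 (V p)),
            add_self_div_two]
      _ ≤ i := hVI.trans h1.le
  have hScut : ∀ k, CutNormLE ν (ε k) fun p => U p - S k p := by
    intro k
    refine cutNormLE_of_continuous ν (hUm.sub (hS k).measurable) (M := 1 + M k)
      (fun p => (abs_sub _ _).trans (add_le_add (hUabs p) (hM k p))) fun f g hf hg hf1 hg1 => ?_
    have hφ : Continuous fun p : Ω × Ω => f p.1 * g p.2 := by fun_prop
    have hφ1 : ∀ p : Ω × Ω, |f p.1 * g p.2| ≤ 1 := fun p => by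
      simpa using abs_mul_le_of_abs_le (hf1 p.1) (hg1 p.2)
    have hSk := hS k
    have h1 := hlim (fun p => ((p.2 : ℝ) - S k p.1) * (f p.1.1 * g p.1.2)) (by fun_prop)
    have i1 : Integrable (fun p : (Ω × Ω) × unitInterval => (p.2 : ℝ) * (f p.1.1 * g p.1.2)) ρ :=
      integrable_of_measurable_of_abs_le (by fun_prop)
        fun p => abs_mul_le_of_abs_le (abs_coe_unitInterval_le p.2) (hφ1 p.1)
    have i2 : Integrable (fun p : (Ω × Ω) × unitInterval => S k p.1 * (f p.1.1 * g p.1.2)) ρ :=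
      integrable_of_measurable_of_abs_le (by fun_prop)
        fun p => abs_mul_le_of_abs_le (hM k p.1) (hφ1 p.1)
    have i3 : Integrable (fun p : Ω × Ω => U p * (f p.1 * g p.2)) (ν.prod ν) :=
      integrable_of_measurable_of_abs_le (by fun_prop)
        fun p => abs_mul_le_of_abs_le (hUabs p) (hφ1 p)
    have i4 : Integrable (fun p : Ω × Ω => S k p * (f p.1 * g p.2)) (ν.prod ν) :=
      integrable_of_measurable_of_abs_le (by fun_prop)
        fun p => abs_mul_le_of_abs_le (hM k p) (hφ1 p)
    have h2 : ∫ p, ((p.2 : ℝ) - S k p.1) * (f p.1.1 * g p.1.2) ∂ρ =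
        ∫ p, (U p - S k p) * (f p.1 * g p.2) ∂(ν.prod ν) := by
      simp_rw [sub_mul]
      rw [integral_sub i1 i2, integral_sub i3 i4, hU _ hφ]
      congr 1
      rw [← hfst, Measure.fst, integral_map measurable_fst.aemeasurable]
      exact (hSk.mul hφ).aestronglyMeasurable
    rw [h2] at h1
    exact le_of_tendsto h1.abs (Eventually.of_forall fun n =>
      hcut n k (fun x => f (c n x)) (fun x => g (c n x)) (hf.measurable.comp (hc n))
        (hg.measurable.comp (hc n)) (fun x => hf1 _) fun x => hg1 _)
  have hSc : ∀ n k, Measurable fun p : X × X => S k (c n p.1, c n p.2) := fun n k => by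
    have := (hS k).measurable
    have := hc n
    fun_prop
  have hWm : ∀ n, Measurable fun p => (W n p : ℝ) := fun n => (hW n).subtype_coe
  have htri : ∀ k j, Tendsto (fun n => triangleForm μ (fun p => W n p)
      (fun p => S k (c n p.1, c n p.2)) fun p => S j (c n p.1, c n p.2)) l
      (𝓝 (triangleForm ν U (S k) (S j))) := by
    intro k j
    have hSk := hS k
    have hSj := hS j
    have h1 := hlim' (fun p => (p.1.2 : ℝ) * S k (p.1.1.2, p.2) * S j (p.2, p.1.1.1))
      (by fun_prop)
    have h2 : ∫ p : ((Ω × Ω) × unitInterval) × Ω,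
        (p.1.2 : ℝ) * S k (p.1.1.2, p.2) * S j (p.2, p.1.1.1) ∂(ρ.prod ν) =
        triangleForm ν U (S k) (S j) := by
      unfold triangleForm
      rw [integral_prod_symm, integral_prod_symm]
      · congr with z
        have := hU (fun p => S k (p.2, z) * S j (z, p.1)) (by fun_prop)
        simp only [← mul_assoc] at this
        exact this.symm
      · exact integrable_triangle hUm hSk.measurable hSj.measurable hUabs (hM k) (hM j)
      · exact integrable_of_measurable_of_abs_le (by fun_prop)
          fun p => abs_mul_le_of_abs_le (abs_mul_le_of_abs_le (abs_coe_unitInterval_le _)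
            (hM k _)) (hM j _)
    rw [h2] at h1
    exact h1
  have hclose : ∀ k j, |t - triangleForm ν U U U| ≤ 2 * (ε k + ε j * M k) := by
    intro k j
    have h1 : |triangleForm ν U U U - triangleForm ν U (S k) (S j)| ≤ ε k + ε j * M k :=
      abs_triangleForm_sub_le hUm (hS k).measurable (hS j).measurable (hM0 k) hUabs (hM k) (hM j)
        (hScut k) (hScut j)
    have h2 : |t - triangleForm ν U (S k) (S j)| ≤ ε k + ε j * M k := by
      refine le_of_tendsto ((htri k j).const_sub t).abs (Eventually.of_forall fun n => ?_)
      rw [← ht n]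
      exact abs_triangleForm_sub_le (hWm n) (hSc n k) (hSc n j) (hM0 k)
        (fun p => abs_coe_unitInterval_le _) (fun p => hM k _) (fun p => hM j _)
        (hcut n k) (hcut n j)
    have h3 := abs_sub_le t (triangleForm ν U (S k) (S j)) (triangleForm ν U U U)
    rw [abs_sub_comm (triangleForm ν U (S k) (S j))] at h3
    linarith
  have ht0 : |t - triangleForm ν U U U| ≤ 0 := by
    have h1 : ∀ k, |t - triangleForm ν U U U| ≤ 2 * (ε k + 0 * M k) := fun k =>
      ge_of_tendsto (((hε.mul_const (M k)).const_add (ε k)).const_mul 2)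
        (Eventually.of_forall fun j => hclose k j)
    have h2 := ge_of_tendsto (hε.const_mul 2) (Eventually.of_forall fun k => by
      simpa using h1 k)
    simpa using h2
  refine ⟨ν, U, inferInstance, hUm, hU01, hUsymm, hUe, ?_, hUI⟩
  linarith [abs_nonpos_iff.1 ht0]

/-- Compactness of graphons for edge and triangle densities, with lower semicontinuity of the
rate. -/
theorem exists_limit_kernel (μ : Measure X) [IsProbabilityMeasure μ]
    {W : ℕ → X × X → unitInterval} (hW : ∀ n, Measurable (W n))
    (hsymm : ∀ n p, W n p.swap = W n p) {e t i : ℝ}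
    (he : ∀ n, ∫ p, (W n p : ℝ) ∂(μ.prod μ) = e)
    (ht : ∀ n, triangleForm μ (fun p => W n p) (fun p => W n p) (fun p => W n p) = t)
    (hi : Tendsto (fun n => ∫ p, I0 (W n p) ∂(μ.prod μ)) atTop (𝓝 i)) :
    ∃ (ν : Measure (ℕ × ℕ × Bool → Icc (-1 : ℝ) 1))
      (U : (ℕ × ℕ × Bool → Icc (-1 : ℝ) 1) × (ℕ × ℕ × Bool → Icc (-1 : ℝ) 1) → ℝ),
      IsProbabilityMeasure ν ∧ Measurable U ∧ (∀ p, U p ∈ Icc (0 : ℝ) 1) ∧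
      (∀ p, U p.swap = U p) ∧ ∫ p, U p ∂(ν.prod ν) = e ∧
      triangleForm ν U U U = t ∧ ∫ p, I0 (U p) ∂(ν.prod ν) ≤ i := by
  let ε : ℕ → ℝ := fun k => 1 / ((k : ℝ) + 1)
  let N : ℕ → ℕ := fun k => (k + 2) ^ 2
  have hε0 : ∀ k, 0 < ε k := fun k => Nat.one_div_pos_of_nat
  have hN : ∀ k, 1 < N k * ε k ^ 2 := fun k => by
    simp only [N, ε]
    push_cast
    rw [← mul_pow, mul_one_div]
    refine one_lt_pow₀ ?_ two_ne_zero
    rw [one_lt_div (by positivity)]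
    linarith
  choose u v hu hv hu1 hv1 hcut using fun n k =>
    exists_cutNormLE_sub_rankOneSum μ (hW n).subtype_coe (fun p => abs_coe_unitInterval_le (W n p))
      (hε0 k) (hN k)
  let c : ℕ → X → (ℕ × ℕ × Bool → Icc (-1 : ℝ) 1) := fun n x s =>
    bif s.2.2 then ⟨u n s.1 s.2.1 x, abs_le.1 (hu1 n s.1 s.2.1 x)⟩
      else ⟨v n s.1 s.2.1 x, abs_le.1 (hv1 n s.1 s.2.1 x)⟩
  have hc : ∀ n, Measurable (c n) := fun n => by
    refine measurable_pi_lambda _ fun ⟨k, j, b⟩ => ?_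
    cases b
    · exact (hv n k j).subtype_mk
    · exact (hu n k j).subtype_mk
  have habs : ∀ w : Icc (-1 : ℝ) 1, |(w : ℝ)| ≤ 1 := fun w => abs_le.2 w.2
  refine exists_limit_kernel_of_code μ hW hsymm hc (S := fun k => rankOneSum (ε k) (N k)
    (fun j p => p (k, j, true)) (fun j p => p (k, j, false))) (fun k => ?_)
    (M := fun k => ε k * N k) (fun k => by have := hε0 k; positivity)
    (fun k => abs_rankOneSum_le (hε0 k).le (fun j p => habs _) fun j p => habs _)
    tendsto_one_div_add_atTop_nhds_zero_nat (fun n k => hcut n k) he ht hi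
  unfold rankOneSum
  fun_prop

end LimitKernel

section Graphon

instance isProbabilityMeasure_unitMeasure : IsProbabilityMeasure unitMeasure :=
  ⟨by simp [unitMeasure]⟩

lemma setIntegral_setIntegral_eq_integral_prod {f : ℝ → ℝ → ℝ}
    (hf : Measurable (Function.uncurry f)) {C : ℝ} (hC : ∀ x y, |f x y| ≤ C) :
    ∫ x in Icc (0 : ℝ) 1, ∫ y in Icc (0 : ℝ) 1, f x y =
      ∫ p, f p.1 p.2 ∂(unitMeasure.prod unitMeasure) :=
  (integral_prod (μ := unitMeasure) (ν := unitMeasure) (Function.uncurry f)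
    (integrable_of_measurable_of_abs_le hf fun p => hC p.1 p.2)).symm

variable {g : ℝ → ℝ → ℝ}

lemma IsGraphon.abs_apply_le (hg : IsGraphon g) (x y : ℝ) : |g x y| ≤ 1 := by
  rw [abs_of_nonneg (hg.2.2 x y).1]
  exact (hg.2.2 x y).2

lemma IsGraphon.edgeDensity_eq (hg : IsGraphon g) :
    edgeDensity g = ∫ p, g p.1 p.2 ∂(unitMeasure.prod unitMeasure) :=
  setIntegral_setIntegral_eq_integral_prod hg.1 hg.abs_apply_le

lemma IsGraphon.rate_eq (hg : IsGraphon g) :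
    rate g = ∫ p, I0 (g p.1 p.2) ∂(unitMeasure.prod unitMeasure) :=
  setIntegral_setIntegral_eq_integral_prod (continuous_I0.measurable.comp hg.1)
    fun x y => abs_I0_le (hg.2.2 x y)

lemma IsGraphon.triangleDensity_eq (hg : IsGraphon g) :
    triangleDensity g = triangleForm unitMeasure (fun p => g p.1 p.2) (fun p => g p.1 p.2)
      (fun p => g p.1 p.2) := by
  have hi := integrable_triangle (μ := unitMeasure) hg.1 hg.1 hg.1 (fun p => hg.abs_apply_le p.1 p.2)
    (fun p => hg.abs_apply_le p.1 p.2) (fun p => hg.abs_apply_le p.1 p.2)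
  exact ((integral_prod _ hi).trans (integral_prod _ hi.integral_prod_left)).symm

lemma IsGraphon.neg_one_le_rate (hg : IsGraphon g) : -1 ≤ rate g := by
  rw [hg.rate_eq]
  exact (abs_le.1 (abs_integral_le_of_abs_le fun p : ℝ × ℝ =>
    abs_I0_le (hg.2.2 p.1 p.2))).1

lemma exists_measurable_map_unitMeasure_eq {Y : Type*} [MeasurableSpace Y] [StandardBorelSpace Y]
    (ν : Measure Y) [IsProbabilityMeasure ν] :
    ∃ τ : ℝ → Y, Measurable τ ∧ unitMeasure.map τ = ν := by
  have : Nonempty Y := ν.nonempty_of_neZero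
  obtain ⟨τ, hτ, hmap⟩ := ν.exists_measurable_map_eq
  have hproj : Measurable (projIcc (0 : ℝ) 1 zero_le_one) := continuous_projIcc.measurable
  refine ⟨τ ∘ projIcc 0 1 zero_le_one, hτ.comp hproj, ?_⟩
  have h : (volume : Measure unitInterval).map Subtype.val = unitMeasure :=
    (measurePreserving_subtype_coe measurableSet_Icc).map_eq
  rw [← h, Measure.map_map (hτ.comp hproj) measurable_subtype_coe, ← hmap]
  congr 1
  ext x
  simp

/-- A symmetric kernel on a standard Borel probability space is represented by a graphon. -/
lemma exists_graphon_of_kernel {Y : Type*} [MeasurableSpace Y] [StandardBorelSpace Y]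
    (ν : Measure Y) [IsProbabilityMeasure ν] {U : Y × Y → ℝ} (hU : Measurable U)
    (hU01 : ∀ p, U p ∈ Icc (0 : ℝ) 1) (hsymm : ∀ p, U p.swap = U p) :
    ∃ g, IsGraphon g ∧ edgeDensity g = ∫ p, U p ∂(ν.prod ν) ∧
      triangleDensity g = triangleForm ν U U U ∧ rate g = ∫ p, I0 (U p) ∂(ν.prod ν) := by
  obtain ⟨τ, hτ, rfl⟩ := exists_measurable_map_unitMeasure_eq ν
  have hg : IsGraphon fun x y => U (τ x, τ y) :=
    ⟨hU.comp (by fun_prop), fun x y => hsymm (τ y, τ x), fun x y => hU01 _⟩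
  have hprod := Measure.map_prod_map unitMeasure unitMeasure hτ hτ
  refine ⟨_, hg, ?_, ?_, ?_⟩
  · rw [hg.edgeDensity_eq, hprod,
      integral_map (hτ.prodMap hτ).aemeasurable hU.aestronglyMeasurable]
    rfl
  · rw [hg.triangleDensity_eq, triangleForm, triangleForm, hprod,
      Measure.map_prod_map _ _ (hτ.prodMap hτ) hτ,
      integral_map ((hτ.prodMap hτ).prodMap hτ).aemeasurable]
    · rfl
    · exact Measurable.aestronglyMeasurable (by fun_prop)
  · rw [hg.rate_eq, hprod, integral_map (hτ.prodMap hτ).aemeasurable]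
    · rfl
    · exact (continuous_I0.measurable.comp hU).aestronglyMeasurable

end Graphon

/-- the infimum of the rate function over the nonempty set of
    graphons with given edge and triangle densities is attained. -/
theorem rate_min_attained (e t : ℝ)
    (hex : ∃ g, IsGraphon g ∧ edgeDensity g = e ∧ triangleDensity g = t) :
    ∃ g₀, IsGraphon g₀ ∧ edgeDensity g₀ = e ∧ triangleDensity g₀ = t ∧
      ∀ g, IsGraphon g → edgeDensity g = e → triangleDensity g = t → rate g₀ ≤ rate g := by
  let R : Set ℝ := {r | ∃ g, IsGraphon g ∧ edgeDensity g = e ∧ triangleDensity g = t ∧ rate g = r}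
  have hne : R.Nonempty := by
    obtain ⟨g, hg, hge, hgt⟩ := hex
    exact ⟨rate g, g, hg, hge, hgt, rfl⟩
  have hbdd : BddBelow R := ⟨-1, by
    rintro r ⟨g, hg, -, -, rfl⟩
    exact hg.neg_one_le_rate⟩
  obtain ⟨r, -, hr, hrR⟩ := exists_seq_tendsto_sInf hne hbdd
  choose g hg hge hgt hgr using hrR
  obtain ⟨ν, U, hν, hU, hU01, hsymm, hUe, hUt, hUi⟩ := exists_limit_kernel unitMeasure
    (W := fun n p => ⟨g n p.1 p.2, (hg n).2.2 p.1 p.2⟩) (fun n => (hg n).1.subtype_mk)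
    (fun n p => Subtype.ext ((hg n).2.1 p.2 p.1)) (e := e) (t := t) (i := sInf R)
    (fun n => (hg n).edgeDensity_eq.symm.trans (hge n))
    (fun n => (hg n).triangleDensity_eq.symm.trans (hgt n))
    (hr.congr fun n => (hgr n).symm.trans (hg n).rate_eq)
  obtain ⟨g₀, hg₀, h1, h2, h3⟩ := exists_graphon_of_kernel ν hU hU01 hsymm
  exact ⟨g₀, hg₀, h1.trans hUe, h2.trans hUt, fun g hg hge hgt =>
    h3.le.trans (hUi.trans (csInf_le hbdd ⟨g, hg, hge, hgt, rfl⟩))⟩
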